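/- Let α ∈ (0,1), 0 < λ < ∞ and x > 0. Let s*(λ) ∈ (w(α), 1) be the unique point satisfying λ (w⁻¹)'(s*)(s* − w(α)) = 1 + λ(w⁻¹(s*) − α), and set ξ_α = G_ξ(1 − α), ξ̲ = G_ξ(1 − w⁻¹(s*(λ))) and X̲ = (λ/(1+λ)) x / ξ̲. Define X* = (λ/(1+λ)) x/ξ on {ξ > ξ_α}, X* = X̲ on {ξ̲ < ξ ≤ ξ_α}, and X* = (λ/(1+λ)) x/ξ on {ξ ≤ ξ̲}. Then E[ξ X*] = x, G_{X*}(α) = X̲, and X* maximizes λ E[(1/T) ln(X/x)] + (1/T) ln(G_X(α)/x) (valued in [−∞, ∞)) over all nonnegative random variables X with E[ξ X] ≤ x; in particular the VaR of the optimal log-return is −(1/T) ln(X̲/x). -/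

import Mathlib

open MeasureTheory ProbabilityTheory Set
open scoped ENNReal NNReal Classical

noncomputable section

/-- Quantile function `G_Y(z) = inf {y | F_Y(y) > z}` of `Y` under `μ`. -/
def qf {Ω : Type*} [MeasurableSpace Ω] (μ : Measure Ω) (Y : Ω → ℝ) (z : ℝ) : ℝ :=
  sInf {y : ℝ | z < (μ {ω | Y ω ≤ y}).toReal}

/-- Extended expectation of a real random variable, valued in `EReal`. -/
def expER {Ω : Type*} [MeasurableSpace Ω] (μ : Measure Ω) (f : Ω → ℝ) : EReal :=
  ((∫⁻ ω, ENNReal.ofReal (f ω) ∂μ : ℝ≥0∞) : EReal)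
    - ((∫⁻ ω, ENNReal.ofReal (-f ω) ∂μ : ℝ≥0∞) : EReal)

/-- Expected log-return `E[(1/T) ln(X/x)]`, with the convention (`ln 0 = -∞`) that it is `-∞`
whenever `X = 0` with positive probability. -/
def expLogRet {Ω : Type*} [MeasurableSpace Ω] (μ : Measure Ω) (T x : ℝ) (X : Ω → ℝ) : EReal :=
  if 0 < μ {ω | X ω = 0} then ⊥
  else expER μ (fun ω => (1 / T) * Real.log (X ω / x))

/-- The distorted identity `w(s) = (1/E[ξ]) ∫_0^s G_ξ(1-z) dz`. -/
def wDist {Ω : Type*} [MeasurableSpace Ω] (μ : Measure Ω) (ξ : Ω → ℝ) (s : ℝ) : ℝ :=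
  (∫ z in (0:ℝ)..s, qf μ ξ (1 - z)) / (∫ ω, ξ ω ∂μ)

/-- The inverse `w⁻¹` of `w` on `[0,1]`. -/
def wInv {Ω : Type*} [MeasurableSpace Ω] (μ : Measure Ω) (ξ : Ω → ℝ) (s : ℝ) : ℝ :=
  Function.invFunOn (wDist μ ξ) (Set.Icc 0 1) s

/-- The mean-VaR objective `λ E[R] − VaR_α(R) = λ E[R] + (1/T) ln(G_X(α)/x)`,
valued in `[-∞, ∞)`, with the convention `ln 0 = -∞`. -/
def objMeanVaR {Ω : Type*} [MeasurableSpace Ω] (μ : Measure Ω)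
    (lam T x α : ℝ) (X : Ω → ℝ) : EReal :=
  (lam : EReal) * expLogRet μ T x X +
    (if qf μ X α = 0 then (⊥ : EReal)
     else (((1 / T) * Real.log (qf μ X α / x) : ℝ) : EReal))

lemma continuous_cdf_of_measure_singleton_eq_zero (ν : Measure ℝ) [IsProbabilityMeasure ν]
    (hν : ∀ a, ν {a} = 0) : Continuous (cdf ν) := by
  rw [continuous_iff_continuousAt]
  intro a
  rw [(monotone_cdf ν).continuousAt_iff_leftLim_eq_rightLim, StieltjesFunction.rightLim_eq]
  have h := (cdf ν).measure_singleton a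
  rw [measure_cdf, hν a, eq_comm, ENNReal.ofReal_eq_zero] at h
  exact le_antisymm ((monotone_cdf ν).leftLim_le le_rfl) (by linarith)

lemma continuous_cdf_of_log_gaussian {Ω : Type*} [MeasurableSpace Ω] {μ : Measure Ω}
    [IsProbabilityMeasure μ] {ξ : Ω → ℝ} (hξm : Measurable ξ)
    {m : ℝ} {v : ℝ≥0} (hv : v ≠ 0) (hlog : μ.map (fun ω => Real.log (ξ ω)) = gaussianReal m v) :
    Continuous (cdf (μ.map ξ)) := by
  have : IsProbabilityMeasure (μ.map ξ) := Measure.isProbabilityMeasure_map hξm.aemeasurable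
  have := nullSingletonClass_gaussianReal (μ := m) hv
  refine continuous_cdf_of_measure_singleton_eq_zero _ fun a => ?_
  rw [Measure.map_apply hξm (measurableSet_singleton a)]
  have h0 : μ.map (fun ω => Real.log (ξ ω)) {Real.log a} = 0 := by
    rw [hlog]; exact measure_singleton _
  rw [Measure.map_apply (by fun_prop) (measurableSet_singleton _)] at h0
  refine measure_mono_null (fun ω hω => ?_) h0
  simp only [mem_preimage, mem_singleton_iff] at hω ⊢
  rw [hω]

lemma strictMonoOn_cdf_of_log_gaussian {Ω : Type*} [MeasurableSpace Ω] {μ : Measure Ω}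
    [IsProbabilityMeasure μ] {ξ : Ω → ℝ} (hξm : Measurable ξ) (hξpos : ∀ ω, 0 < ξ ω)
    {m : ℝ} {v : ℝ≥0} (hv : v ≠ 0) (hlog : μ.map (fun ω => Real.log (ξ ω)) = gaussianReal m v) :
    StrictMonoOn (cdf (μ.map ξ)) (Ioi 0) := by
  have : IsProbabilityMeasure (μ.map ξ) := Measure.isProbabilityMeasure_map hξm.aemeasurable
  intro a ha b hb hab
  by_contra! hcon
  have h1 : (μ.map ξ) (Ioc a b) = 0 := by
    rw [← measure_cdf (μ.map ξ), StieltjesFunction.measure_Ioc, ENNReal.ofReal_eq_zero]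
    linarith
  rw [Measure.map_apply hξm measurableSet_Ioc] at h1
  have h2 : gaussianReal m v (Ioc (Real.log a) (Real.log b)) = 0 := by
    rw [← hlog, Measure.map_apply (by fun_prop) measurableSet_Ioc]
    refine measure_mono_null (fun ω hω => ?_) h1
    exact ⟨(Real.log_lt_log_iff ha (hξpos ω)).1 hω.1, (Real.log_le_log_iff (hξpos ω) hb).1 hω.2⟩
  have h3 := gaussianReal_absolutelyContinuous' m hv h2
  rw [Real.volume_Ioc, ENNReal.ofReal_eq_zero] at h3
  have := Real.log_lt_log ha hab
  linarith

lemma integrable_log_of_log_gaussian {Ω : Type*} [MeasurableSpace Ω] {μ : Measure Ω}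
    {ξ : Ω → ℝ} (hξm : Measurable ξ) {m : ℝ} {v : ℝ≥0}
    (hlog : μ.map (fun ω => Real.log (ξ ω)) = gaussianReal m v) :
    Integrable (fun ω => Real.log (ξ ω)) μ := by
  have h : Integrable id (μ.map (fun ω => Real.log (ξ ω))) := by
    rw [hlog]; exact IsGaussian.integrable_id
  exact h.comp_measurable (by fun_prop)

lemma cdf_lt_cdf_iff {ν : Measure ℝ}
    (hF : StrictMonoOn (cdf (ν)) (Ioi 0)) {a : ℝ} (ha : 0 < a) (y : ℝ) :
    cdf (ν) a < cdf (ν) y ↔ a < y := by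
  refine ⟨fun h => ?_, fun h => hF ha (ha.trans h) h⟩
  by_contra! hya
  exact absurd h (not_lt.2 (monotone_cdf _ hya))

lemma cdf_mem_Ioo {ν : Measure ℝ}
    (hF : StrictMonoOn (cdf (ν)) (Ioi 0)) {a : ℝ} (ha : 0 < a) :
    cdf (ν) a ∈ Ioo (0 : ℝ) 1 :=
  ⟨(cdf_nonneg _ _).trans_lt (hF (half_pos ha) ha (half_lt_self ha)),
    (hF ha (ha.trans (lt_add_one a)) (lt_add_one a)).trans_le (cdf_le_one _ _)⟩

lemma wDist_zero {Ω : Type*} [MeasurableSpace Ω] (μ : Measure Ω) (ξ : Ω → ℝ) :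
    wDist μ ξ 0 = 0 := by simp [wDist]

section Quantile

variable {Ω : Type*} [MeasurableSpace Ω] {μ : Measure Ω} [IsProbabilityMeasure μ] {ξ : Ω → ℝ}

lemma cdf_map_eq {Y : Ω → ℝ} (hY : Measurable Y) (y : ℝ) :
    cdf (μ.map Y) y = (μ {ω | Y ω ≤ y}).toReal := by
  have : IsProbabilityMeasure (μ.map Y) := Measure.isProbabilityMeasure_map hY.aemeasurable
  rw [cdf_eq_real, Measure.real, Measure.map_apply hY measurableSet_Iic]
  rfl

lemma cdf_map_eq_zero (hξm : Measurable ξ) (hξpos : ∀ ω, 0 < ξ ω) {y : ℝ} (hy : y ≤ 0) :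
    cdf (μ.map ξ) y = 0 := by
  rw [cdf_map_eq hξm]
  have : {ω | ξ ω ≤ y} = ∅ := by
    ext ω
    simpa using hy.trans_lt (hξpos ω)
  simp [this]

lemma qf_cdf (hξm : Measurable ξ) (hF : StrictMonoOn (cdf (μ.map ξ)) (Ioi 0)) {a : ℝ} (ha : 0 < a) :
    qf μ ξ (cdf (μ.map ξ) a) = a := by
  have : {y : ℝ | cdf (μ.map ξ) a < (μ {ω | ξ ω ≤ y}).toReal} = Ioi a := by
    ext y
    rw [mem_ofPred_eq, ← cdf_map_eq hξm, cdf_lt_cdf_iff hF ha, mem_Ioi]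
  rw [qf, this, csInf_Ioi]

lemma exists_cdf_eq (hξm : Measurable ξ) (hξpos : ∀ ω, 0 < ξ ω)
    (hFc : Continuous (cdf (μ.map ξ))) {z : ℝ} (hz : z ∈ Ioo (0 : ℝ) 1) :
    ∃ a, 0 < a ∧ cdf (μ.map ξ) a = z := by
  obtain ⟨a, ha⟩ := mem_range_of_exists_le_of_exists_ge hFc
    (((tendsto_cdf_atBot (μ.map ξ)).eventually (Iic_mem_nhds hz.1)).exists)
    (((tendsto_cdf_atTop (μ.map ξ)).eventually (Ici_mem_nhds hz.2)).exists)
  refine ⟨a, ?_, ha⟩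
  by_contra! h
  rw [cdf_map_eq_zero hξm hξpos h] at ha
  exact hz.1.ne ha

lemma qf_pos_and_cdf_qf (hξm : Measurable ξ) (hξpos : ∀ ω, 0 < ξ ω)
    (hFc : Continuous (cdf (μ.map ξ))) (hF : StrictMonoOn (cdf (μ.map ξ)) (Ioi 0))
    {z : ℝ} (hz : z ∈ Ioo (0 : ℝ) 1) : 0 < qf μ ξ z ∧ cdf (μ.map ξ) (qf μ ξ z) = z := by
  obtain ⟨a, ha, rfl⟩ := exists_cdf_eq hξm hξpos hFc hz
  rw [qf_cdf hξm hF ha]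
  exact ⟨ha, rfl⟩

lemma strictMonoOn_qf (hξm : Measurable ξ) (hξpos : ∀ ω, 0 < ξ ω)
    (hFc : Continuous (cdf (μ.map ξ))) (hF : StrictMonoOn (cdf (μ.map ξ)) (Ioi 0)) :
    StrictMonoOn (qf μ ξ) (Ioo 0 1) := by
  intro z hz z' hz' h
  obtain ⟨h1, h2⟩ := qf_pos_and_cdf_qf hξm hξpos hFc hF hz
  obtain ⟨h3, h4⟩ := qf_pos_and_cdf_qf hξm hξpos hFc hF hz'
  rwa [← cdf_lt_cdf_iff hF h1, h2, h4]

lemma continuousAt_qf (hξm : Measurable ξ) (hξpos : ∀ ω, 0 < ξ ω)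
    (hFc : Continuous (cdf (μ.map ξ))) (hF : StrictMonoOn (cdf (μ.map ξ)) (Ioi 0))
    {z : ℝ} (hz : z ∈ Ioo (0 : ℝ) 1) : ContinuousAt (qf μ ξ) z := by
  refine (strictMonoOn_qf hξm hξpos hFc hF).continuousAt_of_image_mem_nhds
    (Ioo_mem_nhds hz.1 hz.2) ?_
  refine Filter.mem_of_superset (Ioi_mem_nhds (qf_pos_and_cdf_qf hξm hξpos hFc hF hz).1) ?_
  exact fun a ha => ⟨_, cdf_mem_Ioo hF ha, qf_cdf hξm hF ha⟩

lemma map_cdf_comp_eq_uniform (hξm : Measurable ξ) (hξpos : ∀ ω, 0 < ξ ω)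
    (hFc : Continuous (cdf (μ.map ξ))) (hF : StrictMonoOn (cdf (μ.map ξ)) (Ioi 0)) :
    μ.map (fun ω => cdf (μ.map ξ) (ξ ω)) = volume.restrict (Ioo (0 : ℝ) 1) := by
  have hm : Measurable (fun ω => cdf (μ.map ξ) (ξ ω)) := hFc.measurable.comp hξm
  have := Measure.isProbabilityMeasure_map (μ := μ) hm.aemeasurable
  refine Measure.ext_of_Iic _ _ fun t => ?_
  rw [Measure.map_apply hm measurableSet_Iic, Measure.restrict_apply measurableSet_Iic]
  rcases le_or_gt t 0 with ht | ht
  · have h1 : (fun ω => cdf (μ.map ξ) (ξ ω)) ⁻¹' Iic t = ∅ := by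
      ext ω
      simpa using ht.trans_lt (cdf_mem_Ioo hF (hξpos ω)).1
    have h2 : Iic t ∩ Ioo (0 : ℝ) 1 = ∅ := by
      ext y
      simp only [mem_inter_iff, mem_Iic, mem_Ioo, mem_empty_iff_false, iff_false]
      rintro ⟨h, h', -⟩
      linarith
    simp [h1, h2]
  rcases lt_or_ge t 1 with ht1 | ht1
  · obtain ⟨a, ha, hat⟩ := exists_cdf_eq hξm hξpos hFc ⟨ht, ht1⟩
    have h1 : (fun ω => cdf (μ.map ξ) (ξ ω)) ⁻¹' Iic t = {ω | ξ ω ≤ a} := by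
      ext ω
      simp only [mem_preimage, mem_Iic, mem_ofPred_eq]
      rw [← not_lt, ← not_lt, ← hat, cdf_lt_cdf_iff hF ha]
    have h2 : Iic t ∩ Ioo (0 : ℝ) 1 = Ioc 0 t := by
      ext y
      simp only [mem_inter_iff, mem_Iic, mem_Ioo, mem_Ioc]
      constructor
      · rintro ⟨h, h', -⟩; exact ⟨h', h⟩
      · rintro ⟨h, h'⟩; exact ⟨h', h, h'.trans_lt ht1⟩
    rw [h1, h2, Real.volume_Ioc, sub_zero, ← hat, cdf_map_eq hξm,
      ENNReal.ofReal_toReal (measure_ne_top _ _)]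
  · have h1 : (fun ω => cdf (μ.map ξ) (ξ ω)) ⁻¹' Iic t = univ := by
      ext ω
      simpa using (cdf_le_one _ _).trans ht1
    have h2 : Iic t ∩ Ioo (0 : ℝ) 1 = Ioo 0 1 := by
      rw [inter_eq_right]
      exact fun y hy => hy.2.le.trans ht1
    simp [h1, h2]

lemma integrableOn_qf (hξm : Measurable ξ) (hξpos : ∀ ω, 0 < ξ ω) (hξint : Integrable ξ μ)
    (hFc : Continuous (cdf (μ.map ξ))) (hF : StrictMonoOn (cdf (μ.map ξ)) (Ioi 0)) :
    IntegrableOn (qf μ ξ) (Ioo 0 1) := by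
  have hG := (aemeasurable_restrict_of_monotoneOn (μ := volume) measurableSet_Ioo
    (strictMonoOn_qf hξm hξpos hFc hF).monotoneOn).aestronglyMeasurable
  have hm : Measurable (fun ω => cdf (μ.map ξ) (ξ ω)) := hFc.measurable.comp hξm
  rw [IntegrableOn]
  rw [← map_cdf_comp_eq_uniform hξm hξpos hFc hF] at hG ⊢
  rw [integrable_map_measure hG hm.aemeasurable]
  refine hξint.congr (Filter.Eventually.of_forall fun ω => ?_)
  exact (qf_cdf hξm hF (hξpos ω)).symm

lemma setIntegral_qf (hξm : Measurable ξ) (hξpos : ∀ ω, 0 < ξ ω)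
    (hFc : Continuous (cdf (μ.map ξ))) (hF : StrictMonoOn (cdf (μ.map ξ)) (Ioi 0))
    {s : Set ℝ} (hs : MeasurableSet s) :
    ∫ z in s ∩ Ioo 0 1, qf μ ξ z = ∫ ω in {ω | cdf (μ.map ξ) (ξ ω) ∈ s}, ξ ω ∂μ := by
  have hG := (aemeasurable_restrict_of_monotoneOn (μ := volume) measurableSet_Ioo
    (strictMonoOn_qf hξm hξpos hFc hF).monotoneOn).aestronglyMeasurable
  have hm : Measurable (fun ω => cdf (μ.map ξ) (ξ ω)) := hFc.measurable.comp hξm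
  rw [← Measure.restrict_restrict hs]
  rw [← map_cdf_comp_eq_uniform hξm hξpos hFc hF] at hG ⊢
  rw [setIntegral_map hs hG hm.aemeasurable]
  refine setIntegral_congr_fun (hm hs) fun ω _ => qf_cdf hξm hF (hξpos ω)

lemma intervalIntegrable_qf (hξm : Measurable ξ) (hξpos : ∀ ω, 0 < ξ ω) (hξint : Integrable ξ μ)
    (hFc : Continuous (cdf (μ.map ξ))) (hF : StrictMonoOn (cdf (μ.map ξ)) (Ioi 0))
    {a b : ℝ} (ha : a ∈ Icc (0 : ℝ) 1) (hb : b ∈ Icc (0 : ℝ) 1) :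
    IntervalIntegrable (qf μ ξ) volume a b := by
  have h : IntervalIntegrable (qf μ ξ) volume 0 1 := by
    rw [intervalIntegrable_iff_integrableOn_Ioo_of_le zero_le_one]
    exact integrableOn_qf hξm hξpos hξint hFc hF
  refine h.mono_set ?_
  rw [uIcc_of_le (zero_le_one' ℝ)]
  exact uIcc_subset_Icc ha hb

lemma wDist_sub_wDist (hξm : Measurable ξ) (hξpos : ∀ ω, 0 < ξ ω) (hξint : Integrable ξ μ)
    (hFc : Continuous (cdf (μ.map ξ))) (hF : StrictMonoOn (cdf (μ.map ξ)) (Ioi 0))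
    {a b : ℝ} (ha : a ∈ Icc (0 : ℝ) 1) (hb : b ∈ Icc (0 : ℝ) 1) :
    wDist μ ξ b - wDist μ ξ a = (∫ z in (1 - b)..(1 - a), qf μ ξ z) / ∫ ω, ξ ω ∂μ := by
  have ha' : 1 - a ∈ Icc (0 : ℝ) 1 := ⟨by linarith [ha.2], by linarith [ha.1]⟩
  have hb' : 1 - b ∈ Icc (0 : ℝ) 1 := ⟨by linarith [hb.2], by linarith [hb.1]⟩
  have h1 : (1 : ℝ) ∈ Icc (0 : ℝ) 1 := ⟨zero_le_one, le_rfl⟩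
  rw [wDist, wDist, intervalIntegral.integral_comp_sub_left, sub_zero,
    intervalIntegral.integral_comp_sub_left, sub_zero, ← sub_div]
  have := intervalIntegral.integral_add_adjacent_intervals
    (intervalIntegrable_qf hξm hξpos hξint hFc hF hb' ha')
    (intervalIntegrable_qf hξm hξpos hξint hFc hF ha' h1)
  rw [← this, add_sub_cancel_right]

lemma integral_pos_of_pos (hξpos : ∀ ω, 0 < ξ ω) (hξint : Integrable ξ μ) :
    0 < ∫ ω, ξ ω ∂μ := by
  rw [integral_pos_iff_support_of_nonneg (fun ω => (hξpos ω).le) hξint]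
  have : Function.support ξ = univ := by
    ext ω; simpa using (hξpos ω).ne'
  simp [this]

lemma strictMonoOn_wDist (hξm : Measurable ξ) (hξpos : ∀ ω, 0 < ξ ω) (hξint : Integrable ξ μ)
    (hFc : Continuous (cdf (μ.map ξ))) (hF : StrictMonoOn (cdf (μ.map ξ)) (Ioi 0)) :
    StrictMonoOn (wDist μ ξ) (Icc 0 1) := by
  intro a ha b hb hab
  rw [← sub_pos, wDist_sub_wDist hξm hξpos hξint hFc hF ha hb]
  refine div_pos ?_ (integral_pos_of_pos hξpos hξint)
  refine intervalIntegral.intervalIntegral_pos_of_pos_on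
    (intervalIntegrable_qf hξm hξpos hξint hFc hF ⟨by linarith [hb.2], by linarith [hb.1]⟩
      ⟨by linarith [ha.2], by linarith [ha.1]⟩) (fun z hz => ?_) (by linarith)
  exact (qf_pos_and_cdf_qf hξm hξpos hFc hF
    ⟨by linarith [hz.1, hb.2], by linarith [hz.2, ha.1]⟩).1

lemma wDist_one (hξm : Measurable ξ) (hξpos : ∀ ω, 0 < ξ ω) (hξint : Integrable ξ μ)
    (hFc : Continuous (cdf (μ.map ξ))) (hF : StrictMonoOn (cdf (μ.map ξ)) (Ioi 0)) :
    wDist μ ξ 1 = 1 := by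
  have h := wDist_sub_wDist hξm hξpos hξint hFc hF (a := 0) (b := 1) (by simp) (by simp)
  rw [wDist_zero, sub_zero, sub_self, sub_zero, intervalIntegral.integral_of_le zero_le_one,
    integral_Ioc_eq_integral_Ioo] at h
  have h2 := setIntegral_qf hξm hξpos hFc hF MeasurableSet.univ
  rw [univ_inter] at h2
  rw [h, h2]
  simpa using div_self (integral_pos_of_pos hξpos hξint).ne'

lemma continuousOn_wDist (hξm : Measurable ξ) (hξpos : ∀ ω, 0 < ξ ω) (hξint : Integrable ξ μ)
    (hFc : Continuous (cdf (μ.map ξ))) (hF : StrictMonoOn (cdf (μ.map ξ)) (Ioi 0)) :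
    ContinuousOn (wDist μ ξ) (Icc 0 1) := by
  unfold wDist
  refine ContinuousOn.div_const ?_ _
  have h : IntervalIntegrable (fun z => qf μ ξ (1 - z)) volume 0 1 := by
    have := (intervalIntegrable_qf hξm hξpos hξint hFc hF (a := 1) (b := 0)
      (by simp) (by simp)).comp_sub_left 1
    simpa using this
  have := intervalIntegral.continuousOn_primitive_interval' h left_mem_uIcc
  rwa [uIcc_of_le zero_le_one] at this

lemma hasDerivAt_wDist (hξm : Measurable ξ) (hξpos : ∀ ω, 0 < ξ ω) (hξint : Integrable ξ μ)
    (hFc : Continuous (cdf (μ.map ξ))) (hF : StrictMonoOn (cdf (μ.map ξ)) (Ioi 0))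
    {b : ℝ} (hb : b ∈ Ioo (0 : ℝ) 1) :
    HasDerivAt (wDist μ ξ) (qf μ ξ (1 - b) / ∫ ω, ξ ω ∂μ) b := by
  unfold wDist
  refine HasDerivAt.div_const ?_ _
  have hb' : 1 - b ∈ Ioo (0 : ℝ) 1 := ⟨by linarith [hb.2], by linarith [hb.1]⟩
  have hc : ∀ y ∈ Ioo (0 : ℝ) 1, ContinuousAt (fun z => qf μ ξ (1 - z)) y := fun y hy =>
    ContinuousAt.comp (f := fun z : ℝ => 1 - z) (g := qf μ ξ)
      (continuousAt_qf hξm hξpos hFc hF ⟨by linarith [hy.2], by linarith [hy.1]⟩)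
      (by fun_prop)
  refine intervalIntegral.integral_hasDerivAt_right ?_ ?_ (hc b hb)
  · have := (intervalIntegrable_qf hξm hξpos hξint hFc hF (a := 1) (b := 1 - b)
      (by simp) (Ioo_subset_Icc_self hb')).comp_sub_left 1
    simpa using this
  · exact ContinuousAt.stronglyMeasurableAtFilter isOpen_Ioo hc b hb

lemma wInv_wDist (hξm : Measurable ξ) (hξpos : ∀ ω, 0 < ξ ω) (hξint : Integrable ξ μ)
    (hFc : Continuous (cdf (μ.map ξ))) (hF : StrictMonoOn (cdf (μ.map ξ)) (Ioi 0))
    {b : ℝ} (hb : b ∈ Icc (0 : ℝ) 1) : wInv μ ξ (wDist μ ξ b) = b :=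
  (strictMonoOn_wDist hξm hξpos hξint hFc hF).injOn.leftInvOn_invFunOn hb

lemma exists_wDist_eq (hξm : Measurable ξ) (hξpos : ∀ ω, 0 < ξ ω) (hξint : Integrable ξ μ)
    (hFc : Continuous (cdf (μ.map ξ))) (hF : StrictMonoOn (cdf (μ.map ξ)) (Ioi 0))
    {s : ℝ} (hs : s ∈ Ioo (0 : ℝ) 1) : ∃ b ∈ Ioo (0 : ℝ) 1, wDist μ ξ b = s := by
  have := intermediate_value_Ioo zero_le_one (continuousOn_wDist hξm hξpos hξint hFc hF)
  rw [wDist_zero, wDist_one hξm hξpos hξint hFc hF] at this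
  exact this hs

lemma hasDerivAt_wInv (hξm : Measurable ξ) (hξpos : ∀ ω, 0 < ξ ω) (hξint : Integrable ξ μ)
    (hFc : Continuous (cdf (μ.map ξ))) (hF : StrictMonoOn (cdf (μ.map ξ)) (Ioi 0))
    {b : ℝ} (hb : b ∈ Ioo (0 : ℝ) 1) :
    HasDerivAt (wInv μ ξ) ((∫ ω, ξ ω ∂μ) / qf μ ξ (1 - b)) (wDist μ ξ b) := by
  have hw := strictMonoOn_wDist hξm hξpos hξint hFc hF
  have hinv : ∀ y ∈ Icc (0 : ℝ) 1, wInv μ ξ (wDist μ ξ y) = y := fun y hy =>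
    wInv_wDist hξm hξpos hξint hFc hF hy
  have hb' := Ioo_subset_Icc_self hb
  have hmem : wDist μ ξ b ∈ Ioo (0 : ℝ) 1 := by
    have h0 := hw (left_mem_Icc.2 zero_le_one) hb' hb.1
    have h1 := hw hb' (right_mem_Icc.2 zero_le_one) hb.2
    rw [wDist_zero] at h0
    rw [wDist_one hξm hξpos hξint hFc hF] at h1
    exact ⟨h0, h1⟩
  have hmono : StrictMonoOn (wInv μ ξ) (Ioo 0 1) := by
    intro s hs t ht hst
    obtain ⟨p, hp, rfl⟩ := exists_wDist_eq hξm hξpos hξint hFc hF hs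
    obtain ⟨q, hq, rfl⟩ := exists_wDist_eq hξm hξpos hξint hFc hF ht
    rw [hinv p (Ioo_subset_Icc_self hp), hinv q (Ioo_subset_Icc_self hq)]
    exact (hw.lt_iff_lt (Ioo_subset_Icc_self hp) (Ioo_subset_Icc_self hq)).1 hst
  have hcont : ContinuousAt (wInv μ ξ) (wDist μ ξ b) := by
    refine hmono.continuousAt_of_image_mem_nhds (Ioo_mem_nhds hmem.1 hmem.2) ?_
    rw [hinv b hb']
    refine Filter.mem_of_superset (Ioo_mem_nhds hb.1 hb.2) fun y hy => ?_
    refine ⟨wDist μ ξ y, ?_, hinv y (Ioo_subset_Icc_self hy)⟩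
    have h0 := hw (left_mem_Icc.2 zero_le_one) (Ioo_subset_Icc_self hy) hy.1
    have h1 := hw (Ioo_subset_Icc_self hy) (right_mem_Icc.2 zero_le_one) hy.2
    rw [wDist_zero] at h0
    rw [wDist_one hξm hξpos hξint hFc hF] at h1
    exact ⟨h0, h1⟩
  have hG : 0 < qf μ ξ (1 - b) := (qf_pos_and_cdf_qf hξm hξpos hFc hF
    ⟨by linarith [hb.2], by linarith [hb.1]⟩).1
  have hE := integral_pos_of_pos hξpos hξint
  have hd := hasDerivAt_wDist hξm hξpos hξint hFc hF hb
  have := HasDerivAt.of_local_left_inverse (f := wDist μ ξ) (g := wInv μ ξ) hcont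
    (by rw [hinv b hb']; exact hd) (div_pos hG hE).ne' ?_
  · rwa [inv_div] at this
  · filter_upwards [Ioo_mem_nhds hmem.1 hmem.2] with s hs
    obtain ⟨p, hp, rfl⟩ := exists_wDist_eq hξm hξpos hξint hFc hF hs
    rw [hinv p (Ioo_subset_Icc_self hp)]

lemma measure_Ioc_cdf (hξm : Measurable ξ) {a b : ℝ} (hab : a ≤ b) :
    μ.real {ω | a < ξ ω ∧ ξ ω ≤ b} = cdf (μ.map ξ) b - cdf (μ.map ξ) a := by
  have : IsProbabilityMeasure (μ.map ξ) := Measure.isProbabilityMeasure_map hξm.aemeasurable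
  have h : (μ.map ξ) (Ioc a b) = ENNReal.ofReal (cdf (μ.map ξ) b - cdf (μ.map ξ) a) := by
    rw [← StieltjesFunction.measure_Ioc, measure_cdf]
  rw [Measure.map_apply hξm measurableSet_Ioc] at h
  rw [Measure.real]
  change (μ (ξ ⁻¹' Ioc a b)).toReal = _
  rw [h, ENNReal.toReal_ofReal (sub_nonneg.2 (monotone_cdf _ hab))]

lemma measure_Ioi_cdf (hξm : Measurable ξ) (a : ℝ) :
    μ.real {ω | a < ξ ω} = 1 - cdf (μ.map ξ) a := by
  have h : {ω | a < ξ ω} = {ω | ξ ω ≤ a}ᶜ := by ext ω; simp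
  rw [h, probReal_compl_eq_one_sub (measurableSet_le hξm measurable_const), cdf_map_eq hξm]
  rfl

lemma wDist_sub_eq_setIntegral (hξm : Measurable ξ) (hξpos : ∀ ω, 0 < ξ ω)
    (hξint : Integrable ξ μ) (hFc : Continuous (cdf (μ.map ξ)))
    (hF : StrictMonoOn (cdf (μ.map ξ)) (Ioi 0)) {a b : ℝ} (ha : a ∈ Ioo (0 : ℝ) 1)
    (hb : b ∈ Ioo (0 : ℝ) 1) (hab : a ≤ b) :
    wDist μ ξ b - wDist μ ξ a =
      (∫ ω in {ω | qf μ ξ (1 - b) < ξ ω ∧ ξ ω ≤ qf μ ξ (1 - a)}, ξ ω ∂μ) / ∫ ω, ξ ω ∂μ := by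
  rw [wDist_sub_wDist hξm hξpos hξint hFc hF (Ioo_subset_Icc_self ha) (Ioo_subset_Icc_self hb),
    intervalIntegral.integral_of_le (by linarith)]
  have h1 : Ioc (1 - b) (1 - a) ∩ Ioo 0 1 = Ioc (1 - b) (1 - a) := by
    rw [inter_eq_left]
    exact fun y hy => ⟨by linarith [hy.1, hb.2], by linarith [hy.2, ha.1]⟩
  obtain ⟨pa, ea⟩ := qf_pos_and_cdf_qf hξm hξpos hFc hF (z := 1 - a)
    ⟨by linarith [ha.2], by linarith [ha.1]⟩
  obtain ⟨pb, eb⟩ := qf_pos_and_cdf_qf hξm hξpos hFc hF (z := 1 - b)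
    ⟨by linarith [hb.2], by linarith [hb.1]⟩
  have h2 : {ω | cdf (μ.map ξ) (ξ ω) ∈ Ioc (1 - b) (1 - a)} =
      {ω | qf μ ξ (1 - b) < ξ ω ∧ ξ ω ≤ qf μ ξ (1 - a)} := by
    ext ω
    simp only [mem_Ioc, mem_ofPred_eq]
    rw [← cdf_lt_cdf_iff hF pb, eb, ← not_lt (b := ξ ω),
      ← cdf_lt_cdf_iff hF pa, ea, not_lt]
  rw [← h1, setIntegral_qf hξm hξpos hFc hF measurableSet_Ioc, h2]

end Quantile

/-- The loss `-1 - (log u - u)` of the normalized Lagrangian at `u = max v 1`. -/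
def lagrangianGap (v : ℝ) : ℝ := max v 1 - 1 - Real.log (max v 1)

lemma lagrangianGap_nonneg (v : ℝ) : 0 ≤ lagrangianGap v := by
  have := Real.log_le_sub_one_of_pos (x := max v 1) (by positivity)
  rw [lagrangianGap]; linarith

lemma log_sub_self_antitone {u v : ℝ} (hu : 1 ≤ u) (huv : u ≤ v) :
    Real.log v - v ≤ Real.log u - u := by
  have hu0 : 0 < u := by linarith
  have hv0 : 0 < v := by linarith
  have h := Real.log_le_sub_one_of_pos (div_pos hv0 hu0)
  rw [Real.log_div hv0.ne' hu0.ne'] at h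
  have h2 : v / u - 1 ≤ v - u := by
    rw [div_sub_one hu0.ne', div_le_iff₀ hu0]
    nlinarith
  linarith

lemma lagrangianGap_mono {u v : ℝ} (huv : u ≤ v) : lagrangianGap u ≤ lagrangianGap v := by
  have := log_sub_self_antitone (le_max_right u 1) (max_le_max_right 1 huv)
  rw [lagrangianGap, lagrangianGap]; linarith

lemma log_sub_self_le_neg_one {a : ℝ} (ha : 0 < a) : Real.log a - a ≤ -1 := by
  linarith [Real.log_le_sub_one_of_pos ha]

lemma log_sub_self_le_of_le {a v : ℝ} (ha : 0 < a) (hv : v ≤ a) :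
    Real.log a - a ≤ -1 - lagrangianGap v := by
  rcases le_total v 1 with h | h
  · have := log_sub_self_le_neg_one ha
    simpa [lagrangianGap, h] using this
  · have := log_sub_self_antitone h hv
    rw [lagrangianGap, max_eq_left h]; linarith

/-- Tangent bound on the plateau of the candidate portfolio. -/
lemma lagrangian_plateau_le {c l q e X : ℝ} (hc : 0 < c) (hl : 0 < l) (he : l ≤ e)
    (hX : 0 < X) (hqX : q ≤ X) :
    Real.log X - Real.log (c / l) - e * (X - c / l) / c ≤ -((e - l) * (q - c / l) / c) := by
  have h := Real.log_le_sub_one_of_pos (div_pos hX (div_pos hc hl))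
  rw [Real.log_div hX.ne' (div_pos hc hl).ne'] at h
  have h1 : X / (c / l) - 1 - e * (X - c / l) / c = -((e - l) * (X - c / l) / c) := by
    field_simp
    ring
  have h2 : (e - l) * (q - c / l) / c ≤ (e - l) * (X - c / l) / c := by
    have : 0 ≤ e - l := by linarith
    gcongr
  linarith

lemma log_sub_mul_div_eq {c e X : ℝ} (hc : 0 < c) (he : 0 < e) (hX : 0 < X) :
    Real.log X - e * X / c
      = Real.log (e * X / c) - e * X / c + Real.log (c / e) := by
  rw [Real.log_div (by positivity) hc.ne', Real.log_mul he.ne' hX.ne',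
    Real.log_div hc.ne' he.ne']
  ring

/-- Wealth `c / e` in the state where the pricing kernel equals `e`, with a plateau `c / l` on
`l < e ≤ h`. -/
def plateauWealth (c l h e : ℝ) : ℝ := if l < e ∧ e ≤ h then c / l else c / e

lemma plateauWealth_pos {c l h e : ℝ} (hc : 0 < c) (hl : 0 < l) (he : 0 < e) :
    0 < plateauWealth c l h e := by
  rw [plateauWealth]
  split_ifs <;> positivity

lemma mul_plateauWealth {c l h e : ℝ} (hl : 0 < l) (he : 0 < e) :
    e * plateauWealth c l h e = c + c / l * (if l < e ∧ e ≤ h then e - l else 0) := by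
  rw [plateauWealth]
  split_ifs <;> field_simp <;> ring

@[fun_prop]
lemma measurable_plateauWealth (c l h : ℝ) : Measurable (plateauWealth c l h) :=
  Measurable.ite measurableSet_Ioc measurable_const (by fun_prop)

/-- Pointwise Lagrangian comparison of a wealth level `X` with the candidate portfolio in the
state where the pricing kernel equals `e`. -/
lemma lagrangian_pointwise_le {c l h q e X : ℝ} (hc : 0 < c) (hl : 0 < l)
    (he : 0 < e) (hq : 0 < q) (hX : 0 < X) :
    Real.log X - Real.log (plateauWealth c l h e)
        - (e * X - e * plateauWealth c l h e) / c
      ≤ -((q - c / l) / c * (if l < e ∧ e ≤ h then e - l else 0))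
        + lagrangianGap (h * q / c)
          * ((if X < q then 1 else 0) - (if h < e then 1 else 0)) := by
  rw [plateauWealth]
  have hK := lagrangianGap_nonneg (h * q / c)
  have hXu : 0 < e * X / c := by positivity
  have hXe := log_sub_mul_div_eq hc he hX
  have hce : e * (c / e) / c = 1 := by field_simp
  by_cases hmid : l < e ∧ e ≤ h
  · rw [if_pos hmid, if_pos hmid, if_neg (not_lt.2 hmid.2)]
    have key : ∀ Y, 0 < Y → q ≤ Y → Real.log Y - Real.log (c / l) - (e * Y - e * (c / l)) / c
        ≤ -((q - c / l) / c * (e - l)) := by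
      intro Y hY hqY
      have := lagrangian_plateau_le hc hl hmid.1.le hY hqY
      rw [mul_sub e] at this
      refine this.trans (le_of_eq ?_)
      ring
    by_cases hA : X < q
    · rw [if_pos hA]
      have hY : 0 < max q (c / e) := by positivity
      have h1 := key _ hY (le_max_left _ _)
      have h2 := log_sub_mul_div_eq hc he hY
      have h3 : e * max q (c / e) / c = max (e * q / c) 1 := by
        rw [mul_max_of_nonneg _ _ he.le, ← max_div_div_right hc.le, hce]
      have h4 : lagrangianGap (e * q / c) ≤ lagrangianGap (h * q / c) := by
        apply lagrangianGap_mono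
        have := hmid.2
        gcongr
      have h5 := log_sub_self_le_neg_one hXu
      rw [h3] at h2
      rw [lagrangianGap] at h4
      rw [sub_div] at h1 ⊢
      rw [h3] at h1
      linarith
    · rw [if_neg hA]
      have := key X hX (not_lt.1 hA)
      linarith
  · rw [if_neg hmid, if_neg hmid]
    have h0 : (e * X - e * (c / e)) / c = e * X / c - 1 := by rw [sub_div, hce]
    have h5 := log_sub_self_le_neg_one hXu
    rw [h0]
    by_cases hB : h < e
    · by_cases hA : X < q
      · rw [if_pos hA, if_pos hB]; linarith
      · rw [if_neg hA, if_pos hB]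
        have h6 := log_sub_self_le_of_le hXu (v := h * q / c) (by
          have := not_lt.1 hA
          gcongr)
        linarith
    · rw [if_neg hB]
      split_ifs <;> linarith

section Objective

variable {Ω : Type*} [MeasurableSpace Ω] {μ : Measure Ω}

lemma expER_eq_integral {f : Ω → ℝ} (hf : Integrable f μ) :
    expER μ f = ((∫ ω, f ω ∂μ : ℝ) : EReal) := by
  have h1 : ∫⁻ ω, ENNReal.ofReal (f ω) ∂μ ≠ ⊤ := hf.lintegral_lt_top.ne
  have h2 : ∫⁻ ω, ENNReal.ofReal (-f ω) ∂μ ≠ ⊤ := hf.neg.lintegral_lt_top.ne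
  rw [expER, integral_eq_lintegral_pos_part_sub_lintegral_neg_part hf, EReal.coe_sub,
    EReal.coe_ennreal_toReal h1, EReal.coe_ennreal_toReal h2]

lemma expER_eq_bot {f g : Ω → ℝ} (hfm : AEStronglyMeasurable f μ) (hg : Integrable g μ)
    (hfg : ∀ᵐ ω ∂μ, f ω ≤ g ω) (hf : ¬ Integrable f μ) : expER μ f = ⊥ := by
  have h1 : ∫⁻ ω, ENNReal.ofReal (f ω) ∂μ ≠ ⊤ := by
    refine ((lintegral_mono_ae ?_).trans_lt hg.lintegral_lt_top).ne
    filter_upwards [hfg] with ω hω using ENNReal.ofReal_le_ofReal hω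
  have h2 : ∫⁻ ω, ENNReal.ofReal (-f ω) ∂μ = ⊤ := by
    by_contra h2
    refine hf ⟨hfm, ?_⟩
    rw [hasFiniteIntegral_iff_norm]
    have : ∀ ω, ENNReal.ofReal ‖f ω‖ = ENNReal.ofReal (f ω) + ENNReal.ofReal (-f ω) := by
      intro ω
      rcases le_total 0 (f ω) with h | h
      · rw [Real.norm_of_nonneg h, ENNReal.ofReal_of_nonpos (neg_nonpos.2 h), add_zero]
      · rw [Real.norm_of_nonpos h, ENNReal.ofReal_of_nonpos h, zero_add]
    simp_rw [this]
    rw [lintegral_add_left' hfm.aemeasurable.ennreal_ofReal]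
    exact ENNReal.add_lt_top.2 ⟨lt_top_iff_ne_top.2 h1, lt_top_iff_ne_top.2 h2⟩
  rw [expER, h2]
  simp

lemma nonneg_of_lt_cdf [IsProbabilityMeasure μ] {X : Ω → ℝ} (hX : ∀ᵐ ω ∂μ, 0 ≤ X ω) {a : ℝ}
    (ha : 0 ≤ a) : ∀ y ∈ {y : ℝ | a < (μ {ω | X ω ≤ y}).toReal}, 0 ≤ y := by
  intro y hy
  by_contra! h
  have : μ {ω | X ω ≤ y} = 0 := by
    refine measure_mono_null (fun ω hω => ?_) hX
    exact not_le.2 (lt_of_le_of_lt hω h)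
  rw [mem_ofPred_eq, this] at hy
  simp at hy
  linarith

lemma measureReal_lt_qf_le [IsProbabilityMeasure μ] {X : Ω → ℝ} (hX : ∀ᵐ ω ∂μ, 0 ≤ X ω) {a : ℝ}
    (ha : 0 ≤ a) : μ.real {ω | X ω < qf μ X a} ≤ a := by
  have hle : ∀ y < qf μ X a, μ {ω | X ω ≤ y} ≤ ENNReal.ofReal a := by
    intro y hy
    by_contra! h
    refine absurd hy (not_lt.2 (csInf_le ⟨0, nonneg_of_lt_cdf hX ha⟩ ?_))
    rwa [mem_ofPred_eq, ← ENNReal.ofReal_lt_iff_lt_toReal ha (measure_ne_top _ _)]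
  obtain ⟨u, hu, hu1, hu2⟩ := exists_seq_strictMono_tendsto (qf μ X a)
  have hU : {ω | X ω < qf μ X a} = ⋃ n, {ω | X ω ≤ u n} := by
    ext ω
    simp only [mem_ofPred_eq, mem_iUnion]
    constructor
    · intro h
      obtain ⟨n, hn⟩ := (hu2.eventually (lt_mem_nhds h)).exists
      exact ⟨n, hn.le⟩
    · rintro ⟨n, hn⟩
      exact hn.trans_lt (hu1 n)
  have hmono : Monotone fun n => {ω | X ω ≤ u n} :=
    fun m n hmn ω hω => le_trans hω (hu.monotone hmn)
  refine ENNReal.toReal_le_of_le_ofReal ha ?_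
  rw [hU, hmono.measure_iUnion]
  exact iSup_le fun n => hle _ (hu1 n)

end Objective

lemma plateau_excess_eq_indicator {Ω : Type*} (ξ : Ω → ℝ) (l h : ℝ) :
    (fun ω => if l < ξ ω ∧ ξ ω ≤ h then ξ ω - l else 0) =
      {ω | l < ξ ω ∧ ξ ω ≤ h}.indicator fun ω => ξ ω - l := by
  ext ω
  rw [indicator_apply]
  congr

section Plateau

variable {Ω : Type*} [MeasurableSpace Ω] {μ : Measure Ω} {ξ : Ω → ℝ}

lemma integrable_plateau_excess [IsFiniteMeasure μ] (hξm : Measurable ξ) (hξint : Integrable ξ μ)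
    (l h : ℝ) : Integrable (fun ω => if l < ξ ω ∧ ξ ω ≤ h then ξ ω - l else 0) μ := by
  rw [plateau_excess_eq_indicator]
  exact (hξint.sub (integrable_const l)).indicator (hξm measurableSet_Ioc)

lemma integral_plateau_excess [IsFiniteMeasure μ] (hξm : Measurable ξ) (hξint : Integrable ξ μ)
    (l h : ℝ) : ∫ ω, (if l < ξ ω ∧ ξ ω ≤ h then ξ ω - l else 0) ∂μ =
      (∫ ω in {ω | l < ξ ω ∧ ξ ω ≤ h}, ξ ω ∂μ) - μ.real {ω | l < ξ ω ∧ ξ ω ≤ h} * l := by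
  have hm : MeasurableSet {ω | l < ξ ω ∧ ξ ω ≤ h} := hξm measurableSet_Ioc
  rw [plateau_excess_eq_indicator, integral_indicator hm, integral_sub hξint.integrableOn
    (integrable_const l), setIntegral_const, smul_eq_mul]

lemma integrable_mul_plateauWealth [IsFiniteMeasure μ] (hξm : Measurable ξ)
    (hξpos : ∀ ω, 0 < ξ ω) (hξint : Integrable ξ μ) {c l h : ℝ} (hl : 0 < l) :
    Integrable (fun ω => ξ ω * plateauWealth c l h (ξ ω)) μ := by
  simp_rw [mul_plateauWealth hl (hξpos _)]
  exact (integrable_const c).add ((integrable_plateau_excess hξm hξint l h).const_mul _)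

lemma integral_mul_plateauWealth [IsProbabilityMeasure μ] (hξm : Measurable ξ)
    (hξpos : ∀ ω, 0 < ξ ω) (hξint : Integrable ξ μ) {c l h : ℝ} (hl : 0 < l) :
    ∫ ω, ξ ω * plateauWealth c l h (ξ ω) ∂μ =
      c + c / l * ∫ ω, (if l < ξ ω ∧ ξ ω ≤ h then ξ ω - l else 0) ∂μ := by
  simp_rw [mul_plateauWealth hl (hξpos _)]
  rw [integral_add (integrable_const c) ((integrable_plateau_excess hξm hξint l h).const_mul _),
    integral_const_mul]
  simp

lemma qf_plateauWealth [IsProbabilityMeasure μ] (hξpos : ∀ ω, 0 < ξ ω) {c l h a : ℝ} (hc : 0 < c)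
    (hl : 0 < l) (ha : μ.real {ω | h < ξ ω} ≤ a) (ha' : a < μ.real {ω | l < ξ ω}) :
    qf μ (fun ω => plateauWealth c l h (ξ ω)) a = c / l := by
  have : {y : ℝ | a < (μ {ω | plateauWealth c l h (ξ ω) ≤ y}).toReal} = Ici (c / l) := by
    ext y
    rw [mem_ofPred_eq, mem_Ici]
    constructor
    · intro hy
      by_contra! hyl
      refine absurd (hy.trans_le (measureReal_mono (s₂ := {ω | h < ξ ω}) fun ω hω => ?_)) ha.not_gt
      rw [mem_ofPred_eq] at hω ⊢
      by_contra! hle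
      rw [plateauWealth] at hω
      split_ifs at hω with hmid
      · linarith
      · have h1 : ξ ω ≤ l := by
          by_contra! h2
          exact hmid ⟨h2, hle⟩
        have := div_le_div_of_nonneg_left hc.le (hξpos ω) h1
        linarith
    · intro hy
      refine ha'.trans_le (measureReal_mono fun ω hω => ?_)
      rw [mem_ofPred_eq] at hω ⊢
      refine le_trans ?_ hy
      rw [plateauWealth]
      split_ifs
      · rfl
      · exact div_le_div_of_nonneg_left hc.le hl hω.le
  rw [qf, this, csInf_Ici]

lemma integrable_log_plateauWealth [IsFiniteMeasure μ] (hξm : Measurable ξ)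
    (hξpos : ∀ ω, 0 < ξ ω) (hlogξ : Integrable (fun ω => Real.log (ξ ω)) μ) {c l h : ℝ}
    (hc : 0 < c) : Integrable (fun ω => Real.log (plateauWealth c l h (ξ ω))) μ := by
  refine Integrable.mono' (g := fun ω => |Real.log (c / l)| + (|Real.log c| + ‖Real.log (ξ ω)‖))
    ((integrable_const _).add ((integrable_const _).add hlogξ.norm))
    (Real.measurable_log.comp ((measurable_plateauWealth c l h).comp hξm)).aestronglyMeasurable
    (Filter.Eventually.of_forall fun ω => ?_)
  rw [Real.norm_eq_abs, Real.norm_eq_abs, plateauWealth]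
  split_ifs
  · have := abs_nonneg (Real.log c)
    have := abs_nonneg (Real.log (ξ ω))
    linarith
  · rw [Real.log_div hc.ne' (hξpos ω).ne']
    have := abs_nonneg (Real.log (c / l))
    have := abs_sub (Real.log c) (Real.log (ξ ω))
    linarith

lemma integral_log_add_log_le [IsProbabilityMeasure μ] (hξm : Measurable ξ)
    (hξpos : ∀ ω, 0 < ξ ω) (hξint : Integrable ξ μ)
    (hlogξ : Integrable (fun ω => Real.log (ξ ω)) μ) {lam c l h q : ℝ} (hlam : 0 < lam)
    (hc : 0 < c) (hl : 0 < l) (hq : 0 < q)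
    (hexc : lam * ∫ ω, (if l < ξ ω ∧ ξ ω ≤ h then ξ ω - l else 0) ∂μ = l)
    {X : Ω → ℝ} (hXm : Measurable X) (hXpos : ∀ᵐ ω ∂μ, 0 < X ω)
    (hlogX : Integrable (fun ω => Real.log (X ω)) μ)
    (hξX : Integrable (fun ω => ξ ω * X ω) μ)
    (hbudget : ∫ ω, ξ ω * X ω ∂μ ≤ ∫ ω, ξ ω * plateauWealth c l h (ξ ω) ∂μ)
    (hXq : μ.real {ω | X ω < q} ≤ μ.real {ω | h < ξ ω}) :
    lam * ∫ ω, Real.log (X ω) ∂μ + Real.log q ≤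
      lam * ∫ ω, Real.log (plateauWealth c l h (ξ ω)) ∂μ + Real.log (c / l) := by
  have iS := integrable_log_plateauWealth (l := l) (h := h) hξm hξpos hlogξ hc
  have iB := integrable_mul_plateauWealth (c := c) (h := h) hξm hξpos hξint hl
  have iE := integrable_plateau_excess hξm hξint l h
  have mA : MeasurableSet {ω | X ω < q} := hXm measurableSet_Iio
  have mB : MeasurableSet {ω | h < ξ ω} := hξm measurableSet_Ioi
  have iA : Integrable (fun ω => if X ω < q then (1 : ℝ) else 0) μ :=
    (integrable_const (1 : ℝ)).indicator mA
  have iA' : Integrable (fun ω => if h < ξ ω then (1 : ℝ) else 0) μ :=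
    (integrable_const (1 : ℝ)).indicator mB
  have eA : ∫ ω, (if X ω < q then (1 : ℝ) else 0) ∂μ = μ.real {ω | X ω < q} :=
    integral_indicator_one mA
  have eA' : ∫ ω, (if h < ξ ω then (1 : ℝ) else 0) ∂μ = μ.real {ω | h < ξ ω} :=
    integral_indicator_one mB
  have hmono := integral_mono_ae
    ((hlogX.sub iS).sub ((hξX.sub iB).div_const c))
    ((iE.const_mul ((q - c / l) / c)).neg.add ((iA.sub iA').const_mul (lagrangianGap (h * q / c))))
    (hXpos.mono fun ω hω => lagrangian_pointwise_le (h := h) hc hl (hξpos ω) hq hω)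
  rw [integral_sub' (hlogX.sub iS) ((hξX.sub iB).div_const c), integral_sub' hlogX iS,
    integral_add' (iE.const_mul ((q - c / l) / c)).neg
      ((iA.sub iA').const_mul (lagrangianGap (h * q / c))), integral_neg', integral_const_mul,
    integral_const_mul, integral_div] at hmono
  simp only [Pi.sub_apply] at hmono
  rw [integral_sub hξX iB, integral_sub iA iA', eA, eA'] at hmono
  set J := ∫ ω, (if l < ξ ω ∧ ξ ω ≤ h then ξ ω - l else 0) ∂μ
  have h1 : (∫ ω, ξ ω * X ω ∂μ - ∫ ω, ξ ω * plateauWealth c l h (ξ ω) ∂μ) / c ≤ 0 :=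
    div_nonpos_of_nonpos_of_nonneg (by linarith) hc.le
  have h2 := mul_nonneg (lagrangianGap_nonneg (h * q / c)) (sub_nonneg.2 hXq)
  have h3 : lam * ((q - c / l) / c * J) = q / (c / l) - 1 := by
    calc lam * ((q - c / l) / c * J) = (q - c / l) / c * (lam * J) := by ring
      _ = _ := by rw [hexc]; field_simp
  have h4 := Real.log_le_sub_one_of_pos (div_pos hq (div_pos hc hl))
  rw [Real.log_div hq.ne' (div_pos hc hl).ne'] at h4
  nlinarith

lemma objMeanVaR_le_plateauWealth [IsProbabilityMeasure μ] (hξm : Measurable ξ)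
    (hξpos : ∀ ω, 0 < ξ ω) (hξint : Integrable ξ μ)
    (hlogξ : Integrable (fun ω => Real.log (ξ ω)) μ) {T lam x c l h a : ℝ} (hT : 0 < T)
    (hlam : 0 < lam) (hx : 0 < x) (hc : 0 < c) (hl : 0 < l) (ha0 : 0 ≤ a)
    (ha : μ.real {ω | h < ξ ω} = a) (ha' : a < μ.real {ω | l < ξ ω})
    (hexc : lam * ∫ ω, (if l < ξ ω ∧ ξ ω ≤ h then ξ ω - l else 0) ∂μ = l)
    (hbudget : ∫ ω, ξ ω * plateauWealth c l h (ξ ω) ∂μ = x)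
    {X : Ω → ℝ} (hXm : Measurable X) (hX0 : ∀ᵐ ω ∂μ, 0 ≤ X ω)
    (hX : ∫⁻ ω, ENNReal.ofReal (ξ ω * X ω) ∂μ ≤ ENNReal.ofReal x) :
    objMeanVaR μ lam T x a X ≤ objMeanVaR μ lam T x a (fun ω => plateauWealth c l h (ξ ω)) := by
  by_cases hz : 0 < μ {ω | X ω = 0}
  · simp [objMeanVaR, expLogRet, hz, EReal.coe_mul_bot_of_pos hlam]
  by_cases hq0 : qf μ X a = 0
  · simp [objMeanVaR, hq0]
  have hq : 0 < qf μ X a := lt_of_le_of_ne (Real.sInf_nonneg (nonneg_of_lt_cdf hX0 ha0)) (Ne.symm hq0)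
  have hXpos : ∀ᵐ ω ∂μ, 0 < X ω := by
    have : ∀ᵐ ω ∂μ, X ω ≠ 0 := by
      rw [ae_iff]; simpa using hz
    filter_upwards [hX0, this] with ω h1 h2 using lt_of_le_of_ne h1 h2.symm
  have hξX0 : ∀ᵐ ω ∂μ, 0 ≤ ξ ω * X ω := hX0.mono fun ω hω => mul_nonneg (hξpos ω).le hω
  have hξXm : AEStronglyMeasurable (fun ω => ξ ω * X ω) μ :=
    (hξm.mul hXm).aestronglyMeasurable
  have hξX : Integrable (fun ω => ξ ω * X ω) μ := by
    refine ⟨hξXm, ?_⟩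
    rw [hasFiniteIntegral_iff_ofReal hξX0]
    exact hX.trans_lt ENNReal.ofReal_lt_top
  by_cases hint : Integrable (fun ω => (1 / T) * Real.log (X ω / x)) μ
  swap
  · have hbot : expER μ (fun ω => (1 / T) * Real.log (X ω / x)) = ⊥ := by
      refine expER_eq_bot (g := fun ω => (1 / T) * (ξ ω * X ω / x - Real.log (ξ ω)))
        ((Real.measurable_log.comp (hXm.div_const x)).const_mul _).aestronglyMeasurable
        (((hξX.div_const x).sub hlogξ).const_mul _) ?_ hint
      filter_upwards [hXpos] with ω hω
      refine mul_le_mul_of_nonneg_left ?_ (by positivity)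
      have h1 := Real.log_le_sub_one_of_pos
        (mul_pos (hξpos ω) (div_pos hω hx))
      rw [Real.log_mul (hξpos ω).ne' (div_pos hω hx).ne', ← mul_div_assoc] at h1
      linarith
    rw [objMeanVaR, expLogRet, if_neg hz, hbot]
    simp [EReal.coe_mul_bot_of_pos hlam]
  have hlogx : ∀ y : ℝ, 0 < y → (1 / T) * Real.log (y / x) =
      (1 / T) * Real.log y - (1 / T) * Real.log x := by
    intro y hy
    rw [Real.log_div hy.ne' hx.ne']
    ring
  have hae : (fun ω => (1 / T) * Real.log (X ω / x)) =ᵐ[μ]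
      fun ω => (1 / T) * Real.log (X ω) - (1 / T) * Real.log x :=
    hXpos.mono fun ω hω => hlogx _ hω
  have hlogX : Integrable (fun ω => Real.log (X ω)) μ := by
    have := ((hint.congr hae).add (integrable_const ((1 / T) * Real.log x))).const_mul T
    refine this.congr (Filter.Eventually.of_forall fun ω => ?_)
    simp only [Pi.add_apply]
    field_simp
    ring
  have hSpos : ∀ ω, 0 < plateauWealth c l h (ξ ω) := fun ω => plateauWealth_pos hc hl (hξpos ω)
  have iS := integrable_log_plateauWealth (l := l) (h := h) hξm hξpos hlogξ hc
  have hSfun : (fun ω => (1 / T) * Real.log (plateauWealth c l h (ξ ω) / x)) =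
      fun ω => (1 / T) * Real.log (plateauWealth c l h (ξ ω)) - (1 / T) * Real.log x :=
    funext fun ω => hlogx _ (hSpos ω)
  have hSint : Integrable (fun ω => (1 / T) * Real.log (plateauWealth c l h (ξ ω)) -
      (1 / T) * Real.log x) μ :=
    (iS.const_mul (1 / T)).sub (integrable_const ((1 / T) * Real.log x))
  have hSz : μ {ω | plateauWealth c l h (ξ ω) = 0} = 0 := by
    have : {ω | plateauWealth c l h (ξ ω) = 0} = ∅ := by
      ext ω; simpa using (hSpos ω).ne'
    rw [this, measure_empty]
  have hbX : ∫ ω, ξ ω * X ω ∂μ ≤ ∫ ω, ξ ω * plateauWealth c l h (ξ ω) ∂μ := by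
    rw [hbudget, integral_eq_lintegral_of_nonneg_ae hξX0 hξXm]
    exact ENNReal.toReal_le_of_le_ofReal hx.le hX
  have key := integral_log_add_log_le hξm hξpos hξint hlogξ hlam hc hl hq hexc hXm hXpos hlogX
    hξX hbX ((measureReal_lt_qf_le hX0 ha0).trans ha.ge)
  have hcl := div_pos hc hl
  have hqS := qf_plateauWealth hξpos hc hl ha.le ha'
  rw [objMeanVaR, objMeanVaR, expLogRet, expLogRet, if_neg hz, if_neg hq0, hqS, if_neg hcl.ne',
    hSz, if_neg (lt_irrefl _), expER_eq_integral hint, hSfun, expER_eq_integral hSint,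
    ← EReal.coe_mul, ← EReal.coe_mul, ← EReal.coe_add, ← EReal.coe_add, EReal.coe_le_coe_iff,
    integral_congr_ae hae, integral_sub (hlogX.const_mul _) (integrable_const _),
    integral_sub (iS.const_mul _) (integrable_const _), integral_const, integral_const_mul,
    integral_const_mul, hlogx _ hq, hlogx _ hcl]
  have := mul_le_mul_of_nonneg_left key (one_div_pos.2 hT).le
  linarith

end Plateau

/-- the mean-VaR efficient portfolio for `0 < λ < ∞`. -/
theorem mean_VaR_efficient_portfolio
    {Ω : Type*} [MeasurableSpace Ω] (μ : Measure Ω) [IsProbabilityMeasure μ]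
    (ξ : Ω → ℝ) (hξm : Measurable ξ) (hξpos : ∀ ω, 0 < ξ ω) (hξint : Integrable ξ μ)
    (T r θ : ℝ) (hT : 0 < T) (hr : 0 < r) (hθ : 0 < θ)
    (hlog : μ.map (fun ω => Real.log (ξ ω))
      = gaussianReal (-(r + θ ^ 2 / 2) * T) ((θ ^ 2 * T).toNNReal))
    (α lam x : ℝ) (hα : α ∈ Set.Ioo (0:ℝ) 1) (hlam : 0 < lam) (hx : 0 < x)
    (sstar : ℝ) (hs : sstar ∈ Set.Ioo (wDist μ ξ α) 1)
    (hseq : lam * deriv (wInv μ ξ) sstar * (sstar - wDist μ ξ α)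
      = 1 + lam * (wInv μ ξ sstar - α))
    (ξα ξlow Xlow : ℝ) (Xstar : Ω → ℝ)
    (hξα : ξα = qf μ ξ (1 - α))
    (hξlow : ξlow = qf μ ξ (1 - wInv μ ξ sstar))
    (hXlow : Xlow = lam / (1 + lam) * x / ξlow)
    (hXstar : ∀ ω, Xstar ω =
      if ξlow < ξ ω ∧ ξ ω ≤ ξα then Xlow else lam / (1 + lam) * x / ξ ω) :
    (∫⁻ ω, ENNReal.ofReal (ξ ω * Xstar ω) ∂μ = ENNReal.ofReal x) ∧
    (qf μ Xstar α = Xlow) ∧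
    (∀ X : Ω → ℝ, Measurable X → (∀ᵐ ω ∂μ, 0 ≤ X ω) →
      ∫⁻ ω, ENNReal.ofReal (ξ ω * X ω) ∂μ ≤ ENNReal.ofReal x →
      objMeanVaR μ lam T x α X ≤ objMeanVaR μ lam T x α Xstar) ∧
    (-((1 / T) * Real.log (qf μ Xstar α / x)) = -((1 / T) * Real.log (Xlow / x))) := by
  have hv : (θ ^ 2 * T).toNNReal ≠ 0 := (Real.toNNReal_pos.2 (by positivity)).ne'
  have hFc := continuous_cdf_of_log_gaussian hξm hv hlog
  have hF := strictMonoOn_cdf_of_log_gaussian hξm hξpos hv hlog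
  have hlogξ := integrable_log_of_log_gaussian hξm hlog
  have hE := integral_pos_of_pos hξpos hξint
  have hw := strictMonoOn_wDist hξm hξpos hξint hFc hF
  have hα' := Ioo_subset_Icc_self hα
  have hs0 : 0 < sstar := by
    have := hw (left_mem_Icc.2 zero_le_one) hα' hα.1
    rw [wDist_zero] at this
    exact this.trans hs.1
  obtain ⟨β, hβ, rfl⟩ := exists_wDist_eq hξm hξpos hξint hFc hF ⟨hs0, hs.2⟩
  have hαβ : α < β := (hw.lt_iff_lt hα' (Ioo_subset_Icc_self hβ)).1 hs.1
  rw [wInv_wDist hξm hξpos hξint hFc hF (Ioo_subset_Icc_self hβ)] at hξlow hseq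
  obtain ⟨hlow, hFlow⟩ := qf_pos_and_cdf_qf hξm hξpos hFc hF (z := 1 - β)
    ⟨by linarith [hβ.2], by linarith [hβ.1]⟩
  have hFα := (qf_pos_and_cdf_qf hξm hξpos hFc hF (z := 1 - α)
    ⟨by linarith [hα.2], by linarith [hα.1]⟩).2
  have hlt := strictMonoOn_qf hξm hξpos hFc hF (a := 1 - β) (b := 1 - α)
    ⟨by linarith [hβ.2], by linarith [hβ.1]⟩ ⟨by linarith [hα.2], by linarith [hα.1]⟩
    (by linarith)
  rw [(hasDerivAt_wInv hξm hξpos hξint hFc hF hβ).deriv,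
    wDist_sub_eq_setIntegral hξm hξpos hξint hFc hF hα hβ hαβ.le] at hseq
  rw [← hξlow] at hlow hFlow hlt hseq
  rw [← hξα] at hFα hlt hseq
  have hmid := measure_Ioc_cdf (μ := μ) hξm hlt.le
  have hup := measure_Ioi_cdf (μ := μ) hξm ξα
  have hup' := measure_Ioi_cdf (μ := μ) hξm ξlow
  rw [hFα, sub_sub_cancel] at hup
  rw [hFlow, sub_sub_cancel] at hup'
  rw [hFα, hFlow] at hmid
  have hexc : lam * ∫ ω, (if ξlow < ξ ω ∧ ξ ω ≤ ξα then ξ ω - ξlow else 0) ∂μ = ξlow := by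
    rw [integral_plateau_excess hξm hξint, hmid]
    field_simp at hseq
    linarith
  have hc : 0 < lam / (1 + lam) * x := by positivity
  have hbudget : ∫ ω, ξ ω * plateauWealth (lam / (1 + lam) * x) ξlow ξα (ξ ω) ∂μ = x := by
    rw [integral_mul_plateauWealth hξm hξpos hξint hlow]
    have : ∫ ω, (if ξlow < ξ ω ∧ ξ ω ≤ ξα then ξ ω - ξlow else 0) ∂μ = ξlow / lam := by
      rw [eq_div_iff hlam.ne', mul_comm]
      exact hexc
    rw [this]
    field_simp
    ring
  obtain rfl : Xstar = fun ω => plateauWealth (lam / (1 + lam) * x) ξlow ξα (ξ ω) := by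
    funext ω
    rw [hXstar, hXlow, plateauWealth]
  have hqf : qf μ (fun ω => plateauWealth (lam / (1 + lam) * x) ξlow ξα (ξ ω)) α = Xlow := by
    rw [hXlow]
    exact qf_plateauWealth hξpos hc hlow hup.le (by linarith)
  refine ⟨?_, hqf, fun X hXm hX0 hX => ?_, by rw [hqf]⟩
  · rw [← ofReal_integral_eq_lintegral_ofReal
      (integrable_mul_plateauWealth hξm hξpos hξint hlow)
      (Filter.Eventually.of_forall fun ω =>
        (mul_pos (hξpos ω) (plateauWealth_pos hc hlow (hξpos ω))).le), hbudget]
  · exact objMeanVaR_le_plateauWealth hξm hξpos hξint hlogξ hT hlam hx hc hlow hα.1.le hup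
      (by linarith) hexc hbudget hXm hX0 hX

end
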